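/- arXiv:2212.02038 — 2 statements merged into one kernel-verified Lean document; each statement's English description precedes it below -/
import Mathlib

section
/- Let N > 2 be an integer and let e = λ(N) denote the exponent of the unit group (ℤ/Nℤ)ˣ. Then the least positive integer f with the property that for all but finitely many prime numbers p one has (p : ℤ/Nℤ)^f = 1 or (p : ℤ/Nℤ)^f = −1, equals e/2 if (ℤ/Nℤ)ˣ is cyclic, and equals e if (ℤ/Nℤ)ˣ is not cyclic. -/
/-- By Dirichlet's theorem, `±1`-valuedness of `p ^ f` for almost all primes `p` is the same as
for all units. -/
theorem finite_setOf_prime_pow_ne_iff {N : ℕ} [NeZero N] (f : ℕ) :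
    {p : ℕ | p.Prime ∧ ¬((p : ZMod N) ^ f = 1 ∨ (p : ZMod N) ^ f = -1)}.Finite ↔
      ∀ u : (ZMod N)ˣ, u ^ f = 1 ∨ u ^ f = -1 := by
  simp only [Units.ext_iff, Units.val_pow_eq_pow_val, Units.val_one, Units.val_neg]
  constructor
  · intro hfin u
    by_contra hu
    obtain ⟨B, hB⟩ := hfin.bddAbove
    obtain ⟨p, hpB, hp, hpu⟩ := Nat.forall_exists_prime_gt_and_eq_mod u.isUnit B
    exact hpB.not_ge (hB ⟨hp, by rwa [hpu]⟩)
  · intro h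
    refine (Set.finite_Iic N).subset fun p ⟨hp, hpf⟩ => ?_
    by_contra hpN
    have hcop : p.Coprime N := (Nat.Prime.coprime_iff_not_dvd hp).2 fun hd =>
      hpN (Nat.le_of_dvd (NeZero.pos N) hd)
    exact hpf (by simpa using h (ZMod.unitOfCoprime p hcop))

theorem ZMod.neg_one_ne_one_of_two_lt {N : ℕ} (hN : 2 < N) : (-1 : ZMod N) ≠ 1 :=
  have : Fact (2 < N) := ⟨hN⟩
  ZMod.neg_one_ne_one

theorem ZMod.units_neg_one_ne_one_of_two_lt {N : ℕ} (hN : 2 < N) : (-1 : (ZMod N)ˣ) ≠ 1 := by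
  simpa [Units.ext_iff] using ZMod.neg_one_ne_one_of_two_lt hN

theorem ZMod.two_dvd_exponent_units {N : ℕ} (hN : 2 < N) : 2 ∣ Monoid.exponent (ZMod N)ˣ := by
  rw [← orderOf_eq_prime (x := (-1 : (ZMod N)ˣ)) (p := 2) (by simp)
    (ZMod.units_neg_one_ne_one_of_two_lt hN)]
  exact Monoid.order_dvd_exponent _

/-- In a finite cyclic group there is at most one element of order two. -/
theorem IsCyclic.eq_one_or_eq_of_sq_eq_one {G : Type*} [Group G] [Finite G] [IsCyclic G]
    {x y : G} (hx : x ^ 2 = 1) (hy : y ^ 2 = 1) (hy1 : y ≠ 1) : x = 1 ∨ x = y := by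
  classical
  have := Fintype.ofFinite G
  by_contra! h
  have hsub : ({1, y, x} : Finset G) ⊆ Finset.univ.filter fun a => a ^ 2 = 1 := by
    intro a
    simp only [Finset.mem_insert, Finset.mem_singleton, Finset.mem_filter, Finset.mem_univ,
      true_and]
    rintro (rfl | rfl | rfl) <;> simp [*]
  have hcard := (Finset.card_le_card hsub).trans (IsCyclic.card_pow_eq_one_le two_pos)
  rw [Finset.card_eq_three.2 ⟨1, y, x, hy1.symm, h.1.symm, h.2.symm, rfl⟩] at hcard
  omega

theorem ZMod.exists_unit_pow_ne_of_coprime_mul {a b f : ℕ} (hab : a.Coprime b) (ha : 2 < a)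
    (hb : 2 < b) (hneg : ∃ u : (ZMod (a * b))ˣ, u ^ f = -1) :
    ∃ u : (ZMod (a * b))ˣ, u ^ f ≠ 1 ∧ u ^ f ≠ -1 := by
  obtain ⟨u, hu⟩ := hneg
  let φ := ZMod.chineseRemainder hab
  have hu' : φ u ^ f = -1 := by
    rw [← map_pow, ← Units.val_pow_eq_pow_val, hu]
    simp
  have hunit_prod : IsUnit ((φ u).1, (1 : ZMod b)) :=
    Prod.isUnit_iff.2 ⟨(Prod.isUnit_iff.1 (u.isUnit.map φ)).1, isUnit_one⟩
  have hunit : IsUnit (φ.symm ((φ u).1, 1)) := hunit_prod.map φ.symm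
  have hpow : φ (hunit.unit : ZMod (a * b)) ^ f = (-1, 1) := by
    ext <;> simp [← Prod.pow_fst, hu']
  refine ⟨hunit.unit, fun h => ?_, fun h => ?_⟩ <;>
    rw [← map_pow, ← Units.val_pow_eq_pow_val, h] at hpow
  · exact ZMod.neg_one_ne_one_of_two_lt ha (by simpa using (congrArg Prod.fst hpow).symm)
  · exact ZMod.neg_one_ne_one_of_two_lt hb (by simpa using congrArg Prod.snd hpow)

theorem ZMod.exists_unit_pow_ne_of_eight_dvd {N f : ℕ} [NeZero N] (h8 : 8 ∣ N)
    (hneg : ∃ u : (ZMod N)ˣ, u ^ f = -1) :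
    ∃ u : (ZMod N)ˣ, u ^ f ≠ 1 ∧ u ^ f ≠ -1 := by
  have map_neg_one : ZMod.unitsMap h8 (-1) = -1 := by
    ext
    simp [ZMod.unitsMap]
  obtain ⟨k, rfl | rfl⟩ := f.even_or_odd'
  · obtain ⟨u, hu⟩ := hneg
    have hsq : ∀ x : (ZMod 8)ˣ, x ^ 2 ≠ -1 := by decide
    refine absurd ?_ (hsq (ZMod.unitsMap h8 u ^ k))
    rw [← pow_mul', ← map_pow, hu, map_neg_one]
  · obtain ⟨v, hv⟩ := ZMod.unitsMap_surjective h8 (ZMod.unitOfCoprime 3 (by norm_num))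
    have hpow : ZMod.unitsMap h8 (v ^ (2 * k + 1)) = ZMod.unitOfCoprime 3 (by norm_num) := by
      rw [map_pow, hv, pow_succ, pow_mul,
        show (ZMod.unitOfCoprime 3 (by norm_num) : (ZMod 8)ˣ) ^ 2 = 1 by decide, one_pow, one_mul]
    refine ⟨v, fun h => ?_, fun h => ?_⟩ <;> rw [h] at hpow
    · rw [map_one] at hpow
      exact absurd hpow (by decide)
    · rw [map_neg_one] at hpow
      exact absurd hpow (by decide)

theorem ZMod.eight_dvd_or_exists_coprime_mul_of_not_isCyclic_units {N : ℕ} (hN : 2 < N)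
    (hc : ¬ IsCyclic (ZMod N)ˣ) :
    8 ∣ N ∨ ∃ a b : ℕ, a.Coprime b ∧ 2 < a ∧ 2 < b ∧ N = a * b := by
  obtain ⟨k, m, hm, rfl⟩ := Nat.exists_eq_two_pow_mul_odd (n := N) (by omega)
  rw [or_iff_not_imp_left]
  intro h8
  have hk : k < 3 := by
    by_contra! hk
    exact h8 ((pow_dvd_pow 2 hk : 2 ^ 3 ∣ 2 ^ k).mul_right m)
  have hm1 : m ≠ 1 := by
    rintro rfl
    interval_cases k
    · omega
    · omega
    · exact hc ((ZMod.isCyclic_units_iff _).2 (by norm_num))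
  have hm2 : 2 < m := by
    obtain ⟨j, rfl⟩ := hm
    omega
  by_cases hk2 : k = 2
  · subst hk2
    exact ⟨2 ^ 2, m, (Nat.coprime_two_left.2 hm).pow_left 2, by norm_num, hm2, rfl⟩
  obtain ⟨p, hp, hpm⟩ := Nat.exists_prime_and_dvd hm1
  obtain ⟨j, c, hpc, rfl⟩ := Nat.exists_eq_pow_mul_and_not_dvd (n := m) (by omega) p hp.ne_one
  have hp_odd : Odd p := hm.of_dvd_nat hpm
  have hc_odd : Odd c := hm.of_dvd_nat (dvd_mul_left _ _)
  have hj : j ≠ 0 := by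
    rintro rfl
    simp [hpc] at hpm
  have hp2 : 2 < p := by
    have := hp.two_le
    obtain ⟨i, rfl⟩ := hp_odd
    omega
  have hc1 : c ≠ 1 := by
    rintro rfl
    have hk' : k = 0 ∨ k = 1 := by omega
    exact hc ((ZMod.isCyclic_units_iff _).2 (.inr (.inr (.inr (.inr
      ⟨p, j, hp, hp_odd, by omega, by rcases hk' with rfl | rfl <;> simp⟩)))))
  have hc2 : 2 < c := by
    obtain ⟨i, rfl⟩ := hc_odd
    omega
  refine ⟨p ^ j, 2 ^ k * c, ?_, hp2.trans_le (Nat.le_self_pow hj p),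
    hc2.trans_le (Nat.le_mul_of_pos_left c (by positivity)), by ring⟩
  exact Nat.Coprime.pow_left j (Nat.Coprime.mul_right
    ((Nat.coprime_two_right.2 hp_odd).pow_right k) ((Nat.Prime.coprime_iff_not_dvd hp).2 hpc))

theorem ZMod.exists_unit_pow_ne_of_not_isCyclic_units {N f : ℕ} (hN : 2 < N)
    (hc : ¬ IsCyclic (ZMod N)ˣ) (hneg : ∃ u : (ZMod N)ˣ, u ^ f = -1) :
    ∃ u : (ZMod N)ˣ, u ^ f ≠ 1 ∧ u ^ f ≠ -1 := by
  have : NeZero N := ⟨by omega⟩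
  obtain h8 | ⟨a, b, hab, ha, hb, rfl⟩ :=
    ZMod.eight_dvd_or_exists_coprime_mul_of_not_isCyclic_units hN hc
  · exact ZMod.exists_unit_pow_ne_of_eight_dvd h8 hneg
  · exact ZMod.exists_unit_pow_ne_of_coprime_mul hab ha hb hneg


/-- Let `N > 2` and let `e` be the exponent of `(ZMod N)ˣ`. The least positive
integer `f` such that for all but finitely many primes `p` one has
`(p : ZMod N) ^ f = 1` or `(p : ZMod N) ^ f = -1` equals `e / 2` if `(ZMod N)ˣ`
is cyclic, and equals `e` otherwise. -/
theorem stmt2 (N : ℕ) (hN : 2 < N) :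
    (IsCyclic (ZMod N)ˣ →
      IsLeast {f : ℕ | 0 < f ∧
          {p : ℕ | p.Prime ∧ ¬((p : ZMod N) ^ f = 1 ∨ (p : ZMod N) ^ f = -1)}.Finite}
        (Monoid.exponent (ZMod N)ˣ / 2)) ∧
    (¬ IsCyclic (ZMod N)ˣ →
      IsLeast {f : ℕ | 0 < f ∧
          {p : ℕ | p.Prime ∧ ¬((p : ZMod N) ^ f = 1 ∨ (p : ZMod N) ^ f = -1)}.Finite}
        (Monoid.exponent (ZMod N)ˣ)) := by
  have : NeZero N := ⟨by omega⟩
  simp only [finite_setOf_prime_pow_ne_iff]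
  have hpos : 0 < Monoid.exponent (ZMod N)ˣ := Nat.pos_of_ne_zero Monoid.exponent_ne_zero_of_finite
  obtain ⟨d, hd⟩ := ZMod.two_dvd_exponent_units hN
  have hdvd : ∀ f : ℕ, (∀ u : (ZMod N)ˣ, u ^ f = 1 ∨ u ^ f = -1) → d ∣ f := fun f hf => by
    refine Nat.dvd_of_mul_dvd_mul_left two_pos (hd ▸ Monoid.exponent_dvd_of_forall_pow_eq_one ?_)
    intro u
    rw [pow_mul']
    rcases hf u with h | h <;> simp [h]
  refine ⟨fun hc => ⟨⟨by omega, fun u => ?_⟩, fun f ⟨hf, hfu⟩ => ?_⟩,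
    fun hc => ⟨⟨hpos, fun u => .inl (Monoid.pow_exponent_eq_one u)⟩, fun f ⟨hf, hfu⟩ => ?_⟩⟩
  · refine IsCyclic.eq_one_or_eq_of_sq_eq_one ?_ (by simp)
      (ZMod.units_neg_one_ne_one_of_two_lt hN)
    rw [← pow_mul, Nat.div_mul_cancel ⟨d, hd⟩, Monoid.pow_exponent_eq_one]
  · rw [hd, Nat.mul_div_cancel_left d two_pos]
    exact Nat.le_of_dvd hf (hdvd f hfu)
  · by_cases hneg : ∃ u : (ZMod N)ˣ, u ^ f = -1
    · obtain ⟨u, hu, hu'⟩ := ZMod.exists_unit_pow_ne_of_not_isCyclic_units hN hc hneg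
      exact absurd (hfu u) (by simp [hu, hu'])
    · exact Monoid.exponent_min' f hf fun u => (hfu u).resolve_right fun h => hneg ⟨u, h⟩
end

section
/- Let p be an odd prime and m = (p−1)/2. Let A be the m × m matrix over (ℤ/pℤ)[X] with (i,j) entry (0-based) (i+j+1)⁻¹ · (X^{i+j+1} − X^{p}). Then (X − 1)^{m²} divides det A in (ℤ/pℤ)[X]. -/
open Polynomial

/-- If the derivative of `F` is a nonzero multiple of `(X - a) ^ k`, where the positive integers up
to `k` are nonzero in the base field, then a zero of `F` at `a` has order at least `k + 1`. -/
theorem Polynomial.X_sub_C_pow_succ_dvd_of_derivative {K : Type*} [Field K] {F : K[X]} {a : K}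
    {k : ℕ} (hk : ∀ n : ℕ, 0 < n → n ≤ k → (n : K) ≠ 0) (hroot : F.IsRoot a)
    (hne : derivative F ≠ 0) (hdvd : (X - C a) ^ k ∣ derivative F) :
    (X - C a) ^ (k + 1) ∣ F := by
  have hF : F ≠ 0 := by
    rintro rfl
    simp at hne
  rw [← le_rootMultiplicity_iff hF]
  by_contra! hlt
  have hpos : 0 < F.rootMultiplicity a := (rootMultiplicity_pos hF).2 hroot
  have hcast := hk _ hpos (by omega)
  have hder := derivative_rootMultiplicity_of_root_of_mem_nonZeroDivisors hroot
    (mem_nonZeroDivisors_of_ne_zero hcast)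
  have hle := (le_rootMultiplicity_iff hne).2 hdvd
  omega

/-- If the `(i, j)` entry of a matrix is divisible by `t ^ (i + j + 1)`, then its `m × m`
determinant is divisible by `t ^ (m ^ 2)`. -/
theorem Matrix.pow_sq_dvd_det {R : Type*} [CommRing R] {m : ℕ} (t : R)
    (M : Matrix (Fin m) (Fin m) R) (h : ∀ i j : Fin m, t ^ ((i : ℕ) + (j : ℕ) + 1) ∣ M i j) :
    t ^ (m ^ 2) ∣ M.det := by
  choose e he using h
  have hM : M = Matrix.of fun i j : Fin m =>
      t ^ (i : ℕ) * (Matrix.of fun i j : Fin m => t ^ ((j : ℕ) + 1) * e i j) i j := by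
    ext i j
    rw [he, Matrix.of_apply, Matrix.of_apply]
    ring
  have hsum (n : ℕ) : ∑ i ∈ Finset.range n, i + ∑ i ∈ Finset.range n, (i + 1) = n ^ 2 := by
    induction n with
    | zero => simp
    | succ n ih =>
      rw [Finset.sum_range_succ, Finset.sum_range_succ]
      linarith
  rw [hM, Matrix.det_mul_column, Matrix.det_mul_row (fun j : Fin m => t ^ ((j : ℕ) + 1)) e,
    ← mul_assoc, Finset.prod_pow_eq_pow_sum, Finset.prod_pow_eq_pow_sum, ← pow_add,
    Fin.sum_univ_eq_sum_range (fun i => i), Fin.sum_univ_eq_sum_range (fun i => i + 1), hsum]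
  exact dvd_mul_right _ _

/-- The matrix whose `i`-th row lists the coefficients of `(X - 1) ^ i`, viewed as constant
polynomials. -/
noncomputable def xSubOnePowCoeffMatrix (R : Type*) [CommRing R] (m : ℕ) :
    Matrix (Fin m) (Fin m) R[X] :=
  Matrix.of fun i a => C (((X - C 1 : R[X]) ^ (i : ℕ)).coeff a)

theorem det_xSubOnePowCoeffMatrix (R : Type*) [CommRing R] [Nontrivial R] (m : ℕ) :
    (xSubOnePowCoeffMatrix R m).det = 1 := by
  have hdeg (i : ℕ) : ((X - C 1 : R[X]) ^ i).natDegree = i := by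
    rw [(monic_X_sub_C (1 : R)).natDegree_pow, natDegree_X_sub_C, mul_one]
  rw [Matrix.det_of_isLowerTriangular]
  · refine Finset.prod_eq_one fun i _ => ?_
    have h := ((monic_X_sub_C (1 : R)).pow (i : ℕ)).coeff_natDegree
    rw [hdeg] at h
    rw [xSubOnePowCoeffMatrix, Matrix.of_apply, h, C_1]
  · intro i a hia
    rw [xSubOnePowCoeffMatrix, Matrix.of_apply, coeff_eq_zero_of_natDegree_lt, C_0]
    rw [hdeg]
    exact hia

theorem sum_xSubOnePowCoeffMatrix_mul_X_pow (R : Type*) [CommRing R] [Nontrivial R] {m : ℕ}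
    (i : Fin m) :
    ∑ a, xSubOnePowCoeffMatrix R m i a * X ^ (a : ℕ) = (X - C 1) ^ (i : ℕ) := by
  conv_rhs => rw [as_sum_range_C_mul_X_pow' (n := m) ((X - C 1 : R[X]) ^ (i : ℕ)) (by
    rw [(monic_X_sub_C (1 : R)).natDegree_pow, natDegree_X_sub_C, mul_one]
    exact i.2)]
  rw [← Fin.sum_univ_eq_sum_range
    (fun a => C (((X - C 1 : R[X]) ^ (i : ℕ)).coeff a) * X ^ a)]
  rfl

/-- For an odd prime `p` and `m = (p - 1) / 2`: `(X - 1) ^ (m ^ 2)` divides the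
determinant of the `m × m` matrix `A` over `(ZMod p)[X]` with `(i, j)` entry
`(i + j + 1)⁻¹ * (X ^ (i + j + 1) - X ^ p)`. -/
theorem stmt13 (p : ℕ) (hp : p.Prime) (hodd : Odd p) :
    ((X : (ZMod p)[X]) - 1) ^ (((p - 1) / 2) ^ 2) ∣
      (Matrix.of fun i j : Fin ((p - 1) / 2) =>
          C (((((i : ℕ) + (j : ℕ) + 1 : ℕ)) : ZMod p)⁻¹) *
            ((X : (ZMod p)[X]) ^ ((i : ℕ) + (j : ℕ) + 1) - (X : (ZMod p)[X]) ^ p)).det := by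
  have : Fact p.Prime := ⟨hp⟩
  set m := (p - 1) / 2 with hm
  have hcast (n : ℕ) (hn : 0 < n) (hnp : n < p) : (n : ZMod p) ≠ 0 := by
    rw [Ne, ZMod.natCast_eq_zero_iff]
    exact Nat.not_dvd_of_pos_of_lt hn hnp
  set A : Matrix (Fin m) (Fin m) (ZMod p)[X] := Matrix.of fun i j : Fin m =>
          C (((((i : ℕ) + (j : ℕ) + 1 : ℕ)) : ZMod p)⁻¹) *
            ((X : (ZMod p)[X]) ^ ((i : ℕ) + (j : ℕ) + 1) - (X : (ZMod p)[X]) ^ p) with hA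
  have hAder (a b : Fin m) : derivative (A a b) = X ^ (a : ℕ) * X ^ (b : ℕ) := by
    have hab : ((((a : ℕ) + (b : ℕ) + 1 : ℕ)) : ZMod p) ≠ 0 := hcast _ (by omega) (by omega)
    rw [hA, Matrix.of_apply, derivative_C_mul, derivative_sub, derivative_X_pow,
      derivative_X_pow, CharP.cast_eq_zero (ZMod p) p, C_0, zero_mul, sub_zero, ← mul_assoc, ← C_mul,
      inv_mul_cancel₀ hab, C_1, one_mul, Nat.add_sub_cancel, pow_add]
  have hAeval (a b : Fin m) : (A a b).eval 1 = 0 := by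
    simp [hA]
  set L := xSubOnePowCoeffMatrix (ZMod p) m with hL
  have hLder (i a : Fin m) : derivative (L i a) = 0 := derivative_C
  have hdet : (L * A * L.transpose).det = A.det := by
    rw [Matrix.det_mul, Matrix.det_mul, Matrix.det_transpose, det_xSubOnePowCoeffMatrix,
      one_mul, mul_one]
  rw [← hdet, ← C_1]
  refine Matrix.pow_sq_dvd_det _ _ fun i j => ?_
  have hder : derivative ((L * A * L.transpose) i j) = (X - C 1) ^ ((i : ℕ) + (j : ℕ)) := by
    rw [pow_add, ← sum_xSubOnePowCoeffMatrix_mul_X_pow, ← sum_xSubOnePowCoeffMatrix_mul_X_pow,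
      ← hL, Finset.sum_mul_sum, Finset.sum_comm]
    simp only [Matrix.mul_apply, Matrix.transpose_apply, derivative_sum, derivative_mul, hLder,
      hAder, Finset.sum_mul, mul_zero, zero_mul, zero_add, add_zero]
    exact Finset.sum_congr rfl fun b _ => Finset.sum_congr rfl fun a _ => by ring
  refine X_sub_C_pow_succ_dvd_of_derivative (fun n hn hnk => hcast n hn (by omega)) ?_ ?_ ?_
  · simp [IsRoot.def, Matrix.mul_apply, eval_finsetSum, hAeval]
  · rw [hder]
    exact pow_ne_zero _ (X_sub_C_ne_zero 1)
  · rw [hder]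
end
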